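/- Let A, B be unital C*-algebras and φ : A → B a linear map. If for some n ≥ 2 the map φ ⊗ id_{M_n(ℂ)} : A ⊗ M_n(ℂ) → B ⊗ M_n(ℂ) is decomposable (a sum of a completely positive map and a completely copositive map), then φ is completely positive. -/

import Mathlib

/-- A finite sum of squares in a C*-algebra is a square. -/
theorem exists_sq_of_sum_aux {C : Type*} [CStarAlgebra C] {ι : Type*} [Fintype ι] (Y : ι → C) :
    ∃ N : C, ∑ r, star (Y r) * Y r = star N * N := by
  let _ : PartialOrder C := CStarAlgebra.spectralOrder _
  have : StarOrderedRing C := CStarAlgebra.spectralOrderedRing _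
  have h : 0 ≤ ∑ r, star (Y r) * Y r :=
    Finset.sum_nonneg fun r _ => star_mul_self_nonneg (Y r)
  exact CStarAlgebra.nonneg_iff_eq_star_mul_self.mp h

/-- A finite sum of squares of matrices over a C*-algebra is a square. -/
theorem exists_sq_of_sum {B : Type*} [CStarAlgebra B] [PartialOrder B] [StarOrderedRing B]
    (m : ℕ) {ι : Type*} [Fintype ι] (X : ι → Matrix (Fin m) (Fin m) B) :
    ∃ N : Matrix (Fin m) (Fin m) B, ∑ r, star (X r) * X r = star N * N := by
  obtain ⟨N, hN⟩ := exists_sq_of_sum_aux (C := CStarMatrix (Fin m) (Fin m) B)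
    (fun r => CStarMatrix.ofMatrix (X r))
  exact ⟨CStarMatrix.ofMatrix.symm N, hN⟩

/-- Entries of a square of a block matrix form a Gram matrix. -/
theorem gram_entries {B : Type*} [Ring B] [StarRing B] {k n : ℕ}
    (N : Matrix (Fin k) (Fin k) (Matrix (Fin n) (Fin n) B)) (i j : Fin k) (x y : Fin n) :
    (star N * N) i j x y = ∑ q, ∑ r, star (N q i r x) * N q j r y := by
  simp [Matrix.mul_apply, Matrix.star_apply, Matrix.sum_apply]

theorem gram_zero {B : Type*} [NormedRing B] [StarRing B] [CStarRing B] [PartialOrder B]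
    [StarOrderedRing B] {k n : ℕ} (f : Fin k → Fin n → B)
    (h : ∑ q, ∑ r, star (f q r) * f q r = 0) (q : Fin k) (r : Fin n) : f q r = 0 := by
  have h1 := (Finset.sum_eq_zero_iff_of_nonneg (fun q _ =>
    Finset.sum_nonneg fun r _ => star_mul_self_nonneg (f q r))).mp h q (Finset.mem_univ _)
  have h2 := (Finset.sum_eq_zero_iff_of_nonneg
    (fun r _ => star_mul_self_nonneg (f q r))).mp h1 r (Finset.mem_univ _)
  exact CStarRing.star_mul_self_eq_zero_iff _ |>.mp h2

theorem gram_nonneg {B : Type*} [NormedRing B] [StarRing B] [PartialOrder B]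
    [StarOrderedRing B] {k n : ℕ} (f : Fin k → Fin n → B) :
    0 ≤ ∑ q, ∑ r, star (f q r) * f q r :=
  Finset.sum_nonneg fun _ _ => Finset.sum_nonneg fun _ _ => star_mul_self_nonneg _

/-- The block matrix `[E_{c x, c y} ⊗ b* b]` is a square. -/
theorem block_sq {A : Type*} [Ring A] [StarRing A] {n : ℕ} (o : Fin n) (c : Fin 2 → Fin n)
    (b : A) :
    (Matrix.of fun x y => Matrix.single (c x) (c y) (star b * b) :
      Matrix (Fin 2) (Fin 2) (Matrix (Fin n) (Fin n) A)) =
    star (Matrix.of fun x y => if x = 0 then Matrix.single o (c y) b else 0) *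
      (Matrix.of fun x y => if x = 0 then Matrix.single o (c y) b else 0) := by
  ext1 x y
  simp [Matrix.mul_apply, Matrix.star_apply, Fin.sum_univ_two, Matrix.star_eq_conjTranspose,
    Matrix.conjTranspose_single]

/-- Key computation: the copositive part vanishes on the corner. -/
theorem corner_key {A B : Type*}
    [Ring A] [StarRing A] [Module ℂ A]
    [NormedRing B] [StarRing B] [CStarRing B] [NormedAlgebra ℂ B] [PartialOrder B]
    [StarOrderedRing B]
    (φ : A →ₗ[ℂ] B) (n : ℕ)
    (θ₁ θ₂ : Matrix (Fin n) (Fin n) A →ₗ[ℂ] Matrix (Fin n) (Fin n) B)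
    (h1 : ∀ k : ℕ, ∀ M : Matrix (Fin k) (Fin k) (Matrix (Fin n) (Fin n) A),
        (∃ N : Matrix (Fin k) (Fin k) (Matrix (Fin n) (Fin n) A), M = star N * N) →
        ∃ N' : Matrix (Fin k) (Fin k) (Matrix (Fin n) (Fin n) B), M.map θ₁ = star N' * N')
    (h2 : ∀ k : ℕ, ∀ M : Matrix (Fin k) (Fin k) (Matrix (Fin n) (Fin n) A),
        (∃ N : Matrix (Fin k) (Fin k) (Matrix (Fin n) (Fin n) A), M = star N * N) →
        ∃ N' : Matrix (Fin k) (Fin k) (Matrix (Fin n) (Fin n) B),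
          M.map (fun X => θ₂ X.transpose) = star N' * N')
    (hs : ∀ M : Matrix (Fin n) (Fin n) A, M.map φ = θ₁ M + θ₂ M)
    (o u : Fin n) (hou : o ≠ u) (b : A) :
    θ₂ (Matrix.single o o (star b * b)) o o = 0 := by
  set a := star b * b with ha
  let c : Fin 2 → Fin n := ![o, u]
  have hsq := block_sq o c b
  obtain ⟨P, hP⟩ := h1 2 _ ⟨_, hsq⟩
  obtain ⟨Q, hQ⟩ := h2 2 _ ⟨_, hsq⟩
  have g1 : ∀ x y k l, θ₁ (Matrix.single (c x) (c y) a) k l =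
      ∑ q, ∑ r, star (P q x r k) * P q y r l := by
    intro x y k l
    rw [← gram_entries, ← hP]; rfl
  have g2 : ∀ x y k l, θ₂ (Matrix.single (c y) (c x) a) k l =
      ∑ q, ∑ r, star (Q q x r k) * Q q y r l := by
    intro x y k l
    rw [← gram_entries, ← hQ, Matrix.map_apply, Matrix.of_apply, Matrix.transpose_single]
  have e : ∀ i j k l : Fin n, (if i = k ∧ j = l then φ a else 0) =
      θ₁ (Matrix.single i j a) k l + θ₂ (Matrix.single i j a) k l := by
    intro i j k l
    rw [← Matrix.add_apply, ← hs, Matrix.map_apply, Matrix.single_apply]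
    split_ifs <;> simp
  -- vanishing of the off-diagonal vector
  have z : ∀ q r, Q q 0 r u = 0 := by
    apply gram_zero (fun q r => Q q 0 r u)
    have h := e o o u u
    rw [if_neg (by simp [hou])] at h
    have a1 := g1 0 0 u u
    have a2 := g2 0 0 u u
    simp only [c, Matrix.cons_val_zero] at a1 a2
    rw [a1, a2] at h
    have p1 := gram_nonneg (fun q r => P q 0 r u)
    have p2 := gram_nonneg (fun q r => Q q 0 r u)
    exact ((add_eq_zero_iff_of_nonneg p1 p2).mp h.symm).2
  have w1 : ∑ q, ∑ r, star (P q 0 r o) * P q 1 r u = φ a := by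
    have h := e o u o u
    have a1 := g1 0 1 o u
    have a2 := g2 1 0 o u
    simp only [c, Matrix.cons_val_zero, Matrix.cons_val_one] at a1 a2
    rw [a1, a2] at h
    simpa [z] using h.symm
  have w2 : ∑ q, ∑ r, star (P q 1 r u) * P q 0 r o = φ a := by
    have h := e u o u o
    have a1 := g1 1 0 u o
    have a2 := g2 0 1 u o
    simp only [c, Matrix.cons_val_zero, Matrix.cons_val_one] at a1 a2
    rw [a1, a2] at h
    simpa [z] using h.symm
  have d1 := e o o o o
  have d2 := e u u u u
  have b1 := g1 0 0 o o
  have b2 := g2 0 0 o o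
  have b3 := g1 1 1 u u
  have b4 := g2 1 1 u u
  simp only [c, Matrix.cons_val_zero, Matrix.cons_val_one, and_self, if_true] at b1 b2 b3 b4 d1 d2
  have s := gram_nonneg (fun q r => Q q 0 r o)
  have t := gram_nonneg (fun q r => Q q 1 r u)
  have p := gram_nonneg (fun q r => P q 0 r o - P q 1 r u)
  simp only [star_sub, sub_mul, mul_sub, Finset.sum_sub_distrib] at p
  rw [w1, w2, ← b1, ← b3] at p
  rw [← b2] at s
  rw [← b4] at t
  have p' : (0 : B) ≤ -(θ₂ (Matrix.single o o a) o o + θ₂ (Matrix.single u u a) u u) := by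
    refine p.trans_eq ?_
    rw [eq_sub_of_add_eq d1.symm, eq_sub_of_add_eq d2.symm]
    abel
  have p'' := neg_nonneg.mp p'
  exact le_antisymm ((le_add_of_nonneg_right t).trans p'') s

/-- C*-case of Theorem 7 / Bhat–Osaka Theorem 3.1: Let `A`, `B`
be unital C*-algebras and `φ : A → B` linear.  If for some `n ≥ 2` the map
`φ ⊗ id_{M_n(ℂ)} : M_n(A) → M_n(B)`, `M ↦ M.map φ`, is decomposable (a sum of
a completely positive and a completely copositive map), then `φ` is completely
positive.  Positivity of a matrix over a C*-algebra means being of the form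
`star N * N`; a map is completely copositive iff its composition with the
transpose (`id ⊗ t`) is completely positive. -/
theorem stmt13 {A B : Type*}
    [NormedRing A] [StarRing A] [CStarRing A] [NormedAlgebra ℂ A]
    [CompleteSpace A] [StarModule ℂ A] [PartialOrder A] [StarOrderedRing A]
    [NormedRing B] [StarRing B] [CStarRing B] [NormedAlgebra ℂ B]
    [CompleteSpace B] [StarModule ℂ B] [PartialOrder B] [StarOrderedRing B]
    (φ : A →ₗ[ℂ] B) (n : ℕ) (hn : 2 ≤ n)
    (hdec : ∃ θ₁ θ₂ : Matrix (Fin n) (Fin n) A →ₗ[ℂ] Matrix (Fin n) (Fin n) B,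
      -- θ₁ is completely positive
      (∀ k : ℕ, ∀ M : Matrix (Fin k) (Fin k) (Matrix (Fin n) (Fin n) A),
        (∃ N : Matrix (Fin k) (Fin k) (Matrix (Fin n) (Fin n) A), M = star N * N) →
        ∃ N' : Matrix (Fin k) (Fin k) (Matrix (Fin n) (Fin n) B), M.map θ₁ = star N' * N') ∧
      -- θ₂ is completely copositive
      (∀ k : ℕ, ∀ M : Matrix (Fin k) (Fin k) (Matrix (Fin n) (Fin n) A),
        (∃ N : Matrix (Fin k) (Fin k) (Matrix (Fin n) (Fin n) A), M = star N * N) →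
        ∃ N' : Matrix (Fin k) (Fin k) (Matrix (Fin n) (Fin n) B),
          M.map (fun X => θ₂ X.transpose) = star N' * N') ∧
      -- φ ⊗ id_{M_n(ℂ)} = θ₁ + θ₂
      (∀ M : Matrix (Fin n) (Fin n) A, M.map φ = θ₁ M + θ₂ M)) :
    -- φ is completely positive
    ∀ m : ℕ, ∀ M : Matrix (Fin m) (Fin m) A,
      (∃ N : Matrix (Fin m) (Fin m) A, M = star N * N) → ∃ N' : Matrix (Fin m) (Fin m) B, M.map φ = star N' * N' := by
  obtain ⟨θ₁, θ₂, h1, h2, hs⟩ := hdec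
  letI cA : CStarAlgebra A := {}
  letI cB : CStarAlgebra B := {}
  let o : Fin n := ⟨0, by omega⟩
  let u : Fin n := ⟨1, by omega⟩
  have hou : o ≠ u := by simp [o, u]
  have key := corner_key φ n θ₁ θ₂ h1 h2 hs o u hou
  have key1 : ∀ a : A, θ₂ (Matrix.single o o a) o o = 0 := by
    intro a
    have ha : a ∈ Submodule.span ℂ {a : A | 0 ≤ a} := by
      rw [CStarAlgebra.span_nonneg]; trivial
    induction ha using Submodule.span_induction with
    | mem x hx =>
      obtain ⟨b, rfl⟩ := CStarAlgebra.nonneg_iff_eq_star_mul_self.mp hx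
      exact key b
    | zero => simp
    | add x y _ _ hx hy => rw [Matrix.single_add, map_add, Matrix.add_apply, hx, hy, add_zero]
    | smul c x _ hx => rw [← Matrix.smul_single, map_smul, Matrix.smul_apply, hx, smul_zero]
  have key2 : ∀ a : A, φ a = θ₁ (Matrix.single o o a) o o := by
    intro a
    have h := congrFun (congrFun (hs (Matrix.single o o a)) o) o
    rw [Matrix.add_apply, key1, add_zero] at h
    simpa using h
  rintro m M ⟨N, rfl⟩
  obtain ⟨P, hP⟩ := h1 m ((star N * N).map (Matrix.single o o)) ⟨N.map (Matrix.single o o), by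
    ext i j x y
    simp only [Matrix.map_apply, Matrix.mul_apply, Matrix.star_apply,
      Matrix.star_eq_conjTranspose, Matrix.conjTranspose_single, Matrix.single_mul_single_same,
      Matrix.sum_apply, Matrix.single_apply, Matrix.conjTranspose_apply]
    split_ifs <;> simp⟩
  obtain ⟨N', hN'⟩ := exists_sq_of_sum m
    (fun r : Fin n => (Matrix.of fun q j => P q j r o : Matrix (Fin m) (Fin m) B))
  refine ⟨N', ?_⟩
  rw [← hN']
  ext i j
  rw [Matrix.map_apply, key2]
  have h := congrFun (congrFun (congrFun (congrFun hP i) j) o) o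
  rw [gram_entries, Finset.sum_comm] at h
  simpa [Matrix.sum_apply, Matrix.mul_apply, Matrix.star_apply] using h
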